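/- There exist a smooth function f : ℝ³ → ℝ with sup_{x∈ℝ³} ‖∇f(x)‖ < 1 and a constant c ≠ 0 such that: (i) for some constant C and all ‖x‖ ≥ 1, ‖∇f(x)‖ ≤ C‖x‖^{−2/3} and ‖∇²f(x)‖ ≤ C‖x‖^{−5/3} — so that the induced initial data of the spacelike graph t = f(x) in Minkowski spacetime, namely g_{ij} = δ_{ij} − ∂ᵢf ∂ⱼf and k_{ij} = ∂ᵢ∂ⱼf / √(1 − ‖∇f‖²), satisfy g = δ + O(r^{−4/3}) and k = O(r^{−5/3}); and (ii) the ADM angular momentum limit lim_{r→∞} (1/8π) ∫_{S_r} Σ_{i,j} π_{ij} Yⁱ νʲ dA exists and equals c ≠ 0, where π_{ij} = k_{ij} − (Σ_{a,b} g^{ab} k_{ab}) g_{ij} with (g^{ab}) the inverse matrix of (g_{ab}), Y(x) = (−x₂, x₁, 0) is the rotation field x¹∂₂ − x²∂₁, ν(x) = x/‖x‖, S_r = {x ∈ ℝ³ : ‖x‖ = r}, and dA is the Euclidean surface measure on S_r. In particular, there are asymptotically flat spacelike hypersurfaces in the Minkowski spacetime with finite, nonzero ADM angular momentum. -/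

import Mathlib

open MeasureTheory Real Filter

/-- Euclidean 3-space. -/
abbrev E3 : Type := EuclideanSpace ℝ (Fin 3)

/-- The unit sphere `S² ⊂ ℝ³`. -/
abbrev Sphere2 : Type := Metric.sphere (0 : E3) 1

/-- The surface measure on the unit sphere `S² ⊂ ℝ³` (total measure `4π`);
the Euclidean surface measure on the sphere `S_r` of radius `r` is its pushforward
under `x ↦ r • x`, weighted by `r²`. -/
noncomputable def sphereMeasure : Measure Sphere2 :=
  (volume : Measure E3).toSphere

/-- The partial derivative `∂ᵢ f`. -/
noncomputable def pderiv (f : E3 → ℝ) (i : Fin 3) (x : E3) : ℝ :=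
  fderiv ℝ f x (EuclideanSpace.single i 1)

/-- The Euclidean length `‖∇f(x)‖` of the gradient. -/
noncomputable def gradNorm (f : E3 → ℝ) (x : E3) : ℝ :=
  Real.sqrt (∑ i, (pderiv f i x) ^ 2)

/-- The Hessian `∂ᵢ∂ⱼ f`. -/
noncomputable def hess (f : E3 → ℝ) (i j : Fin 3) (x : E3) : ℝ :=
  pderiv (pderiv f j) i x

/-- The Euclidean norm `‖∇²f(x)‖` of the Hessian. -/
noncomputable def hessNorm (f : E3 → ℝ) (x : E3) : ℝ :=
  Real.sqrt (∑ i, ∑ j, (hess f i j x) ^ 2)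

/-- The induced metric `g_{ij} = δ_{ij} − ∂ᵢf ∂ⱼf` of the spacelike graph
`t = f(x)` in Minkowski spacetime. -/
noncomputable def inducedMetric (f : E3 → ℝ) (x : E3) : Matrix (Fin 3) (Fin 3) ℝ :=
  fun i j => (if i = j then 1 else 0) - pderiv f i x * pderiv f j x

/-- The second fundamental form `k_{ij} = ∂ᵢ∂ⱼf / √(1 − ‖∇f‖²)` of the graph. -/
noncomputable def secondFF (f : E3 → ℝ) (x : E3) : Matrix (Fin 3) (Fin 3) ℝ :=
  fun i j => hess f i j x / Real.sqrt (1 - (gradNorm f x) ^ 2)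

/-- The momentum tensor `π_{ij} = k_{ij} − (tr_g k) g_{ij}`, with the trace taken
using the inverse matrix of `g`. -/
noncomputable def momentumTensor (f : E3 → ℝ) (x : E3) : Matrix (Fin 3) (Fin 3) ℝ :=
  fun i j => secondFF f x i j -
    (∑ a, ∑ b, (inducedMetric f x)⁻¹ a b * secondFF f x a b) * inducedMetric f x i j

/-- The rotation field `Y = x¹∂₂ − x²∂₁`, i.e. `Y(x) = (−x₂, x₁, 0)`. -/
def rotationField (x : E3) : Fin 3 → ℝ := ![-(x 1), x 0, 0]

/-- The ADM angular-momentum integrand `Σ_{i,j} π_{ij} Yⁱ νʲ` with `ν(y) = y/‖y‖`. -/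
noncomputable def admAngMomIntegrand (f : E3 → ℝ) (y : E3) : ℝ :=
  ∑ i, ∑ j, momentumTensor f y i j * rotationField y i * (y j / ‖y‖)


noncomputable def FF (a : ℝ) (p : E3 → ℝ) (y : E3) : ℝ :=
  (1 + ‖y‖ ^ 2) ^ a * p ((1 + ‖y‖ ^ 2) ^ (-(1:ℝ)/2) • y)

lemma FF_contDiff (a : ℝ) (p : E3 → ℝ) (hp : ContDiff ℝ (⊤ : ℕ∞) p) :
    ContDiff ℝ (⊤ : ℕ∞) (FF a p) := by
  have hs : ∀ a : ℝ, ContDiff ℝ (⊤ : ℕ∞) (fun y : E3 => (1 + ‖y‖ ^ 2) ^ a) := by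
    intro a
    apply ContDiff.rpow_const_of_ne
    · exact contDiff_const.add (contDiff_norm_sq ℝ)
    · intro x; positivity
  exact (hs a).mul (hp.comp ((hs _).smul contDiff_id))

lemma hasFDerivAt_s (a : ℝ) (y : E3) :
    HasFDerivAt (fun y : E3 => (1 + ‖y‖ ^ 2) ^ a)
      ((2 * a * (1 + ‖y‖ ^ 2) ^ (a - 1)) • innerSL ℝ y) y := by
  have h1 : HasFDerivAt (fun y : E3 => 1 + ‖y‖ ^ 2) ((2:ℝ) • innerSL ℝ y) y := by
    have := (hasStrictFDerivAt_norm_sq y).hasFDerivAt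
    have h2 := this.const_add 1
    refine h2.congr_fderiv ?_
    ext1 v
    simp [two_smul]
  have h2 := h1.rpow_const (p := a) (Or.inl (by positivity))
  refine h2.congr_fderiv ?_
  ext1 v
  simp only [smul_apply, smul_eq_mul]
  ring

lemma pderiv_FF (a : ℝ) (p : E3 → ℝ) (hp : Differentiable ℝ p) (i : Fin 3) :
    pderiv (FF a p) i = FF (a - 1/2) (fun X => 2 * a * X i * p X
      + fderiv ℝ p X (EuclideanSpace.single i 1) - X i * fderiv ℝ p X X) := by
  funext y
  have hs := hasFDerivAt_s a y
  have hX : HasFDerivAt (fun y : E3 => (1 + ‖y‖ ^ 2) ^ (-(1:ℝ)/2) • y) _ y :=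
    (hasFDerivAt_s (-(1:ℝ)/2) y).smul (hasFDerivAt_id y)
  have hP := (hp ((1 + ‖y‖ ^ 2) ^ (-(1:ℝ)/2) • y)).hasFDerivAt.comp (f := fun y : E3 => (1 + ‖y‖ ^ 2) ^ (-(1:ℝ)/2) • y) y hX
  have h := hs.mul hP
  have h' : HasFDerivAt (FF a p) _ y := h
  unfold pderiv
  rw [h'.fderiv]
  have spos : 0 < 1 + ‖y‖ ^ 2 := by positivity
  unfold FF
  set s := 1 + ‖y‖ ^ 2
  have e1 : s ^ (a - 1) = s ^ (a - 1/2) * s ^ (-(1:ℝ)/2) := by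
    rw [← Real.rpow_add spos]; congr 1; ring
  have e2 : s ^ a * s ^ (-(1:ℝ)/2) = s ^ (a - 1/2) := by
    rw [← Real.rpow_add spos]; congr 1; ring
  have e3 : s ^ a * s ^ (-(1:ℝ)/2 - 1) = s ^ (a - 1/2) * s ^ (-(1:ℝ)/2) * s ^ (-(1:ℝ)/2) := by
    rw [← Real.rpow_add spos, ← Real.rpow_add spos, ← Real.rpow_add spos]; congr 1; ring
  simp only [e1, Function.comp, add_apply, smul_apply,
    ContinuousLinearMap.comp_apply, ContinuousLinearMap.smulRight_apply, innerSL_apply_apply,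
    smul_eq_mul, map_add, map_smul, EuclideanSpace.inner_single_right, PiLp.smul_apply,
    ContinuousLinearMap.id_apply]
  simp only [conj_trivial, one_mul]
  generalize fderiv ℝ p (s ^ (-(1:ℝ)/2) • y) = D
  linear_combination (D (EuclideanSpace.single i 1)) * e2 - (y i * D y) * e3

/-- Kronecker delta -/
def dl (i j : Fin 3) : ℝ := if i = j then 1 else 0

noncomputable def p0 (X : E3) : ℝ := (X 0 + X 0 * X 1) / 100
noncomputable def P1 (j : Fin 3) (X : E3) : ℝ :=
  (dl j 0 * (1 + X 1) + dl j 1 * X 0 - X j * (2/3 * X 0 + 5/3 * (X 0 * X 1))) / 100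
noncomputable def DP1 (j : Fin 3) (X v : E3) : ℝ :=
  (dl j 0 * v 1 + dl j 1 * v 0 - v j * (2/3 * X 0 + 5/3 * (X 0 * X 1))
    - X j * (2/3 * v 0 + 5/3 * (v 0 * X 1 + X 0 * v 1))) / 100
noncomputable def H2 (i j : Fin 3) (X : E3) : ℝ :=
  -(2/3) * X i * P1 j X + DP1 j X (EuclideanSpace.single i 1) - X i * DP1 j X X

lemma hasFDerivAt_coord (i : Fin 3) (X : E3) :
    HasFDerivAt (fun X : E3 => X i) (EuclideanSpace.proj i : E3 →L[ℝ] ℝ) X :=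
  (EuclideanSpace.proj i : E3 →L[ℝ] ℝ).hasFDerivAt

lemma contDiff_coord (i : Fin 3) : ContDiff ℝ (⊤ : ℕ∞) (fun X : E3 => X i) :=
  (EuclideanSpace.proj i : E3 →L[ℝ] ℝ).contDiff

lemma p0_contDiff : ContDiff ℝ (⊤ : ℕ∞) p0 := by
  unfold p0
  have h0 := contDiff_coord 0
  have h1 := contDiff_coord 1
  fun_prop

lemma P1_contDiff (j : Fin 3) : ContDiff ℝ (⊤ : ℕ∞) (P1 j) := by
  unfold P1
  have h0 := contDiff_coord 0
  have h1 := contDiff_coord 1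
  have h2 := contDiff_coord j
  fun_prop

lemma fderiv_p0 (X v : E3) : fderiv ℝ p0 X v = (v 0 + v 0 * X 1 + X 0 * v 1) / 100 := by
  have h := ((hasFDerivAt_coord 0 X).add ((hasFDerivAt_coord 0 X).mul
    (hasFDerivAt_coord 1 X))).mul_const (1/100)
  have h' : HasFDerivAt p0 _ X := h.congr_of_eventuallyEq (Filter.Eventually.of_forall
    (fun Y => by simp only [p0, Pi.add_apply, Pi.mul_apply]; ring))
  rw [h'.fderiv]
  simp
  ring

lemma fderiv_P1 (j : Fin 3) (X v : E3) : fderiv ℝ (P1 j) X v = DP1 j X v := by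
  have c0 := hasFDerivAt_coord 0 X
  have c1 := hasFDerivAt_coord 1 X
  have cj := hasFDerivAt_coord j X
  have h := ((((c1.const_add 1).const_mul (dl j 0)).add (c0.const_mul (dl j 1))).sub
    (cj.mul ((c0.const_mul (2/3)).add ((c0.mul c1).const_mul (5/3))))).mul_const (1/100)
  have h' : HasFDerivAt (P1 j) _ X := h.congr_of_eventuallyEq (Filter.Eventually.of_forall
    (fun Y => by
      simp only [P1, Pi.add_apply, Pi.mul_apply, Pi.sub_apply]; ring))
  rw [h'.fderiv]
  simp [DP1]
  ring

noncomputable def f0 : E3 → ℝ := FF (1/6) p0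

lemma pderiv_f0 (j : Fin 3) : pderiv f0 j = FF (-1/3) (P1 j) := by
  unfold f0
  rw [pderiv_FF _ _ (p0_contDiff.differentiable (by simp))]
  norm_num only
  congr 1
  funext X
  rw [fderiv_p0, fderiv_p0]
  fin_cases j <;> simp [P1, p0, dl] <;> ring

lemma hess_f0 (i j : Fin 3) : hess f0 i j = FF (-5/6) (H2 i j) := by
  unfold hess
  funext x
  rw [pderiv_f0, pderiv_FF _ _ ((P1_contDiff j).differentiable (by simp))]
  norm_num only
  congr 1
  funext X
  rw [fderiv_P1, fderiv_P1]
  simp only [H2]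

open scoped Pointwise in
lemma sphere_inv (e : E3 ≃ₗᵢ[ℝ] E3) (h : E3 → ℝ) :
    ∫ x : Sphere2, h (e (x : E3)) ∂sphereMeasure = ∫ x : Sphere2, h (x : E3) ∂sphereMeasure := by
  let φ : Sphere2 ≃ₜ Sphere2 :=
    { toFun := fun x => ⟨e x.1, by simp⟩
      invFun := fun x => ⟨e.symm x.1, by simp⟩
      left_inv := fun x => by simp
      right_inv := fun x => by simp
      continuous_toFun := by fun_prop
      continuous_invFun := by fun_prop }
  have hφ : MeasurePreserving φ sphereMeasure sphereMeasure := by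
    refine ⟨φ.continuous.measurable, ?_⟩
    ext s hs
    rw [Measure.map_apply φ.continuous.measurable hs]
    unfold sphereMeasure
    rw [Measure.toSphere_apply' _ hs, Measure.toSphere_apply' _ (φ.continuous.measurable hs)]
    congr 1
    have : (Set.Ioo (0:ℝ) 1 • (Subtype.val '' (φ ⁻¹' s)) : Set E3)
        = e ⁻¹' (Set.Ioo (0:ℝ) 1 • (Subtype.val '' s)) := by
      ext y
      simp only [Set.mem_smul, Set.mem_image, Set.mem_preimage]
      constructor
      · rintro ⟨r, hr, z, ⟨w, hw, rfl⟩, rfl⟩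
        exact ⟨r, hr, e w, ⟨φ w, hw, rfl⟩, by simp⟩
      · rintro ⟨r, hr, z, ⟨w, hw, rfl⟩, hy⟩
        refine ⟨r, hr, e.symm w, ⟨φ.symm w, by simpa using hw, rfl⟩, ?_⟩
        apply e.injective
        rw [← hy]; simp
    rw [this]
    exact e.measurePreserving.measure_preimage_equiv (f := e.toMeasurableEquiv) _
  exact hφ.integral_comp φ.measurableEmbedding (fun x : Sphere2 => h x)

lemma sphere_inv' (T : E3 →ₗ[ℝ] E3) (hT : ∀ x, ‖T x‖ = ‖x‖) (h : E3 → ℝ) :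
    ∫ x : Sphere2, h (T (x : E3)) ∂sphereMeasure = ∫ x : Sphere2, h (x : E3) ∂sphereMeasure := by
  have := sphere_inv ((⟨T, hT⟩ : E3 →ₗᵢ[ℝ] E3).toLinearIsometryEquiv rfl) h
  simpa using this

lemma sphere_plane (a b c d : ℝ) (h1 : a ^ 2 + c ^ 2 = 1) (h2 : b ^ 2 + d ^ 2 = 1)
    (h3 : a * b + c * d = 0) (h : ℝ → ℝ → ℝ → ℝ) :
    ∫ x : Sphere2, h (a * x.1 0 + b * x.1 1) (c * x.1 0 + d * x.1 1) (x.1 2) ∂sphereMeasure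
      = ∫ x : Sphere2, h (x.1 0) (x.1 1) (x.1 2) ∂sphereMeasure := by
  let T : E3 →ₗ[ℝ] E3 :=
    { toFun := fun x => !₂[a * x 0 + b * x 1, c * x 0 + d * x 1, x 2]
      map_add' := fun x y => by
        ext i; fin_cases i <;> simp <;> ring
      map_smul' := fun r x => by
        ext i; fin_cases i <;> simp <;> ring }
  have hT : ∀ x, ‖T x‖ = ‖x‖ := by
    intro x
    rw [← sq_eq_sq₀ (norm_nonneg _) (norm_nonneg _), EuclideanSpace.real_norm_sq_eq,
      EuclideanSpace.real_norm_sq_eq, Fin.sum_univ_three, Fin.sum_univ_three]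
    simp [T]
    linear_combination x 0 ^ 2 * h1 + x 1 ^ 2 * h2 + 2 * x 0 * x 1 * h3
  have := sphere_inv' T hT (fun x => h (x 0) (x 1) (x 2))
  simpa [T] using this

lemma sphere_swap12 (h : ℝ → ℝ → ℝ → ℝ) :
    ∫ x : Sphere2, h (x.1 0) (x.1 2) (x.1 1) ∂sphereMeasure
      = ∫ x : Sphere2, h (x.1 0) (x.1 1) (x.1 2) ∂sphereMeasure := by
  let T : E3 →ₗ[ℝ] E3 :=
    { toFun := fun x => !₂[x 0, x 2, x 1]
      map_add' := fun x y => by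
        ext i; fin_cases i <;> simp
      map_smul' := fun r x => by
        ext i; fin_cases i <;> simp }
  have hT : ∀ x, ‖T x‖ = ‖x‖ := by
    intro x
    rw [← sq_eq_sq₀ (norm_nonneg _) (norm_nonneg _), EuclideanSpace.real_norm_sq_eq,
      EuclideanSpace.real_norm_sq_eq, Fin.sum_univ_three, Fin.sum_univ_three]
    simp [T]
    ring
  have := sphere_inv' T hT (fun x => h (x 0) (x 1) (x 2))
  simpa [T] using this

lemma sphere_flip (h : ℝ → ℝ → ℝ → ℝ) :
    ∫ x : Sphere2, h (x.1 0) (-x.1 1) (x.1 2) ∂sphereMeasure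
      = ∫ x : Sphere2, h (x.1 0) (x.1 1) (x.1 2) ∂sphereMeasure := by
  have := sphere_plane 1 0 0 (-1) (by norm_num) (by norm_num) (by norm_num) h
  simpa using this

lemma sphere_swap (h : ℝ → ℝ → ℝ → ℝ) :
    ∫ x : Sphere2, h (x.1 1) (x.1 0) (x.1 2) ∂sphereMeasure
      = ∫ x : Sphere2, h (x.1 0) (x.1 1) (x.1 2) ∂sphereMeasure := by
  have := sphere_plane 0 1 1 0 (by norm_num) (by norm_num) (by norm_num) h
  simpa using this

instance : IsFiniteMeasure sphereMeasure := by unfold sphereMeasure; infer_instance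

lemma sphere_integrable (h : Sphere2 → ℝ) (hc : Continuous h) :
    Integrable h sphereMeasure := by
  have : CompactSpace Sphere2 := isCompact_iff_compactSpace.mp (isCompact_sphere _ _)
  exact hc.integrable_of_hasCompactSupport (HasCompactSupport.of_compactSpace h)

lemma sphere_iadd (f g : Sphere2 → ℝ) (hf : Continuous f) (hg : Continuous g) :
    ∫ x, (f x + g x) ∂sphereMeasure = ∫ x, f x ∂sphereMeasure + ∫ x, g x ∂sphereMeasure :=
  integral_add (sphere_integrable f hf) (sphere_integrable g hg)

lemma sphere_isub (f g : Sphere2 → ℝ) (hf : Continuous f) (hg : Continuous g) :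
    ∫ x, (f x - g x) ∂sphereMeasure = ∫ x, f x ∂sphereMeasure - ∫ x, g x ∂sphereMeasure :=
  integral_sub (sphere_integrable f hf) (sphere_integrable g hg)

lemma cont_coord (i : Fin 3) : Continuous (fun x : Sphere2 => x.1 i) := by fun_prop

lemma sphere_sq (x : Sphere2) : x.1 0 ^ 2 + x.1 1 ^ 2 + x.1 2 ^ 2 = 1 := by
  have h := EuclideanSpace.real_norm_sq_eq x.1
  rw [Fin.sum_univ_three] at h
  have h2 : ‖x.1‖ = 1 := by simp
  rw [← h, h2]; norm_num

lemma moment_lin : ∫ x : Sphere2, x.1 1 ∂sphereMeasure = 0 := by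
  have := sphere_flip (fun _ b _ => b)
  rw [integral_neg] at this
  linarith

lemma moment_diff : ∫ x : Sphere2, (x.1 0 ^ 2 - x.1 1 ^ 2) ∂sphereMeasure = 0 := by
  have := sphere_swap (fun a b _ => a ^ 2 - b ^ 2)
  have h2 : ∫ x : Sphere2, (x.1 1 ^ 2 - x.1 0 ^ 2) ∂sphereMeasure
    = - ∫ x : Sphere2, (x.1 0 ^ 2 - x.1 1 ^ 2) ∂sphereMeasure := by
    rw [← integral_neg]; congr 1; ext x; ring
  linarith
/-- second, mixed fourth and pure fourth moments -/
lemma moments : ∃ B : ℝ, 0 < B ∧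
    (∫ x : Sphere2, x.1 0 ^ 2 * x.1 1 ^ 2 ∂sphereMeasure = B) ∧
    (∫ x : Sphere2, x.1 0 ^ 4 ∂sphereMeasure = 3 * B) ∧
    (∫ x : Sphere2, x.1 1 ^ 4 ∂sphereMeasure = 3 * B) ∧
    (∫ x : Sphere2, x.1 0 ^ 2 ∂sphereMeasure = 5 * B) ∧
    (∫ x : Sphere2, x.1 1 ^ 2 ∂sphereMeasure = 5 * B) := by
  have s1 := sphere_swap (fun a _ _ => a ^ 4)
  have s2 := sphere_swap (fun a _ _ => a ^ 2)
  have s3 := sphere_swap12 (fun _ a _ => a ^ 2)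
  have s4 := sphere_swap12 (fun a b _ => a ^ 2 * b ^ 2)
  have k2 : ((√2)⁻¹ : ℝ) ^ 2 = 1 / 2 := by rw [inv_pow, Real.sq_sqrt (by norm_num)]; norm_num
  have s5 := sphere_plane (√2)⁻¹ (√2)⁻¹ (√2)⁻¹ (-(√2)⁻¹) (by linarith) (by rw [neg_sq]; linarith)
    (by ring) (fun a b _ => a ^ 2 * b ^ 2)
  have e5 : ∀ x : Sphere2, ((√2)⁻¹ * x.1 0 + (√2)⁻¹ * x.1 1) ^ 2 *
      ((√2)⁻¹ * x.1 0 + -(√2)⁻¹ * x.1 1) ^ 2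
      = (1/4) * x.1 0 ^ 4 + (1/4) * x.1 1 ^ 4 - (1/2) * (x.1 0 ^ 2 * x.1 1 ^ 2) := by
    intro x
    generalize ((√2)⁻¹ : ℝ) = k at k2
    have k4 : k ^ 4 = 1 / 4 := by rw [show k ^ 4 = (k ^ 2) ^ 2 by ring, k2]; norm_num
    linear_combination (x.1 0 ^ 2 - x.1 1 ^ 2) ^ 2 * k4
  simp only [e5] at s5
  simp (disch := fun_prop) only [sphere_isub, sphere_iadd, integral_const_mul] at s5
  have e6 : ∀ x : Sphere2, x.1 0 ^ 2 = x.1 0 ^ 4 + x.1 0 ^ 2 * x.1 1 ^ 2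
      + x.1 0 ^ 2 * x.1 2 ^ 2 := by
    intro x
    linear_combination (-(x.1 0 ^ 2)) * sphere_sq x
  have s6 : ∫ x : Sphere2, x.1 0 ^ 2 ∂sphereMeasure = ∫ x : Sphere2, (x.1 0 ^ 4
      + x.1 0 ^ 2 * x.1 1 ^ 2 + x.1 0 ^ 2 * x.1 2 ^ 2) ∂sphereMeasure :=
    integral_congr_ae (Filter.Eventually.of_forall e6)
  simp (disch := fun_prop) only [sphere_iadd] at s6
  have s7 : ∫ x : Sphere2, (x.1 0 ^ 2 + x.1 1 ^ 2 + x.1 2 ^ 2) ∂sphereMeasure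
      = sphereMeasure.real Set.univ := by
    simp only [sphere_sq]; simp
  simp (disch := fun_prop) only [sphere_iadd] at s7
  have hpos : 0 < sphereMeasure.real Set.univ := by
    have : NeZero sphereMeasure := ⟨Measure.toSphere_ne_zero _⟩
    exact measureReal_univ_pos
  refine ⟨_, ?_, rfl, ?_, ?_, ?_, ?_⟩ <;> linarith

lemma gradNorm_sq (f : E3 → ℝ) (y : E3) : gradNorm f y ^ 2 = ∑ i, (pderiv f i y) ^ 2 := by
  unfold gradNorm
  rw [Real.sq_sqrt]
  positivity

lemma inducedMetric_inv (f : E3 → ℝ) (y : E3) (h : gradNorm f y ^ 2 < 1) :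
    (inducedMetric f y)⁻¹ = Matrix.of fun a b => (if a = b then 1 else 0)
      + pderiv f a y * pderiv f b y / (1 - gradNorm f y ^ 2) := by
  apply Matrix.inv_eq_right_inv
  have h1 : 1 - gradNorm f y ^ 2 ≠ 0 := by linarith
  have h2 := gradNorm_sq f y
  rw [Fin.sum_univ_three] at h2
  ext i j
  rw [Matrix.mul_apply, Fin.sum_univ_three]
  simp only [Matrix.of_apply]
  unfold inducedMetric
  generalize gradNorm f y ^ 2 = G at *
  subst h2
  fin_cases i <;> fin_cases j <;> simp <;> field_simp <;> ring

lemma integrand_eq (f : E3 → ℝ) (y : E3) (h : gradNorm f y ^ 2 < 1) :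
    admAngMomIntegrand f y = (1 / ‖y‖) * (1 / √(1 - gradNorm f y ^ 2)) *
      ((∑ i, ∑ j, hess f i j y * rotationField y i * y j) +
        (∑ i, pderiv f i y * rotationField y i) * (∑ i, pderiv f i y * y i) *
        ((∑ i, hess f i i y) + (∑ a, ∑ b, pderiv f a y * pderiv f b y * hess f a b y)
          / (1 - gradNorm f y ^ 2))) := by
  unfold admAngMomIntegrand momentumTensor
  rw [inducedMetric_inv f y h]
  simp only [Matrix.of_apply]
  unfold inducedMetric secondFF
  generalize gradNorm f y ^ 2 = G at *
  simp only [div_eq_mul_inv]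
  generalize (√(1 - G))⁻¹ = W
  generalize (1 - G)⁻¹ = V
  simp [Fin.sum_univ_three, rotationField]
  ring

noncomputable def al (X : E3) : ℝ := ∑ i, ∑ j, H2 i j X * rotationField X i * X j
noncomputable def be (X : E3) : ℝ := ∑ i, P1 i X * rotationField X i
noncomputable def ga (X : E3) : ℝ := ∑ i, P1 i X * X i
noncomputable def de (X : E3) : ℝ := ∑ i, H2 i i X
noncomputable def qq (X : E3) : ℝ := ∑ a, ∑ b, P1 a X * P1 b X * H2 a b X
noncomputable def gg (X : E3) : ℝ := ∑ i, P1 i X ^ 2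

noncomputable def Phi (l t : ℝ) (X : E3) : ℝ :=
  l * (al X * gg X / (√(1 - t * gg X) * (1 + √(1 - t * gg X)))
    + be X * ga X * (de X + t * qq X / (1 - t * gg X)) / √(1 - t * gg X))

lemma P1_cont (j : Fin 3) : Continuous (P1 j) := (P1_contDiff j).continuous
lemma H2_cont (i j : Fin 3) : Continuous (H2 i j) := by
  have := P1_cont j
  unfold H2 DP1
  fun_prop
lemma rot_cont (i : Fin 3) : Continuous (fun X => rotationField X i) := by
  unfold rotationField
  fin_cases i <;> simp <;> fun_prop
lemma al_cont : Continuous al := by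
  have := H2_cont; have := rot_cont
  unfold al; fun_prop
lemma be_cont : Continuous be := by
  have := P1_cont; have := rot_cont
  unfold be; fun_prop
lemma ga_cont : Continuous ga := by
  have := P1_cont
  unfold ga; fun_prop
lemma de_cont : Continuous de := by
  have := H2_cont
  unfold de; fun_prop
lemma qq_cont : Continuous qq := by
  have := P1_cont; have := H2_cont
  unfold qq; fun_prop
lemma gg_cont : Continuous gg := by
  have := P1_cont
  unfold gg; fun_prop

lemma coord_le (X : E3) (hX : ‖X‖ ≤ 1) (i : Fin 3) : |X i| ≤ 1 :=
  (PiLp.norm_apply_le X i).trans hX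

lemma gg_nonneg (X : E3) : 0 ≤ gg X := by unfold gg; positivity

lemma P1_le (X : E3) (hX : ‖X‖ ≤ 1) (j : Fin 3) : |P1 j X| ≤ 6 / 100 := by
  have h0 := coord_le X hX 0
  have h1 := coord_le X hX 1
  have hj := coord_le X hX j
  have h01 : |X 0 * X 1| ≤ 1 := by rw [abs_mul]; exact mul_le_one₀ h0 (abs_nonneg _) h1
  have hw : |2/3 * X 0 + 5/3 * (X 0 * X 1)| ≤ 7/3 := by
    rw [abs_le] at *; constructor <;> linarith [h0.1, h0.2, h01.1, h01.2]
  have hp : |X j * (2/3 * X 0 + 5/3 * (X 0 * X 1))| ≤ 7/3 := by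
    rw [abs_mul]; nlinarith [abs_nonneg (X j), abs_nonneg (2/3 * X 0 + 5/3 * (X 0 * X 1))]
  unfold P1
  generalize X j * (2/3 * X 0 + 5/3 * (X 0 * X 1)) = t at *
  rw [abs_le] at *
  fin_cases j <;> simp [dl] <;> constructor <;> linarith [h0.1, h0.2, h1.1, h1.2, hp.1, hp.2]

lemma gg_le (X : E3) (hX : ‖X‖ ≤ 1) : gg X ≤ 1 / 4 := by
  unfold gg
  have : ∀ j, P1 j X ^ 2 ≤ 1 / 12 := by
    intro j
    have := abs_le.mp (P1_le X hX j)
    nlinarith [this.1, this.2]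
  rw [Fin.sum_univ_three]
  linarith [this 0, this 1, this 2]

/-- rescaled point -/
lemma norm_resc (y : E3) : ‖(1 + ‖y‖ ^ 2) ^ (-(1:ℝ)/2) • y‖ ≤ 1 := by
  rw [norm_smul, ← sq_le_one_iff₀ (by positivity), mul_pow, Real.norm_eq_abs, sq_abs,
    ← Real.rpow_natCast (_ ^ _) 2, ← Real.rpow_mul (by positivity)]
  norm_num
  rw [Real.rpow_neg_one, inv_mul_le_iff₀ (by positivity)]
  linarith

lemma gradNorm_f0_sq (y : E3) : gradNorm f0 y ^ 2 =
    ((1 + ‖y‖ ^ 2) ^ (-(1:ℝ)/3)) ^ 2 * gg ((1 + ‖y‖ ^ 2) ^ (-(1:ℝ)/2) • y) := by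
  rw [gradNorm_sq]
  simp only [pderiv_f0, FF, gg, Finset.mul_sum, mul_pow]

lemma gradNorm_f0_le (y : E3) : gradNorm f0 y ≤ (1 + ‖y‖ ^ 2) ^ (-(1:ℝ)/3) * (1 / 2) := by
  have h0 : 0 ≤ gradNorm f0 y := Real.sqrt_nonneg _
  refine (sq_le_sq₀ h0 (by positivity)).mp ?_
  rw [gradNorm_f0_sq, mul_pow]
  apply mul_le_mul_of_nonneg_left _ (by positivity)
  have := gg_le _ (norm_resc y)
  linarith

lemma s_le_one (y : E3) : (1 + ‖y‖ ^ 2) ^ (-(1:ℝ)/3) ≤ 1 :=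
  Real.rpow_le_one_of_one_le_of_nonpos (by nlinarith [norm_nonneg y]) (by norm_num)

lemma s_le_pow (y : E3) (hy : 1 ≤ ‖y‖) (a : ℝ) (ha : a ≤ 0) :
    (1 + ‖y‖ ^ 2) ^ a ≤ ‖y‖ ^ (2 * a) := by
  rw [Real.rpow_mul (norm_nonneg _)]
  apply Real.rpow_le_rpow_of_nonpos (by positivity) _ ha
  norm_num

lemma hessNorm_f0_le : ∃ C, 0 ≤ C ∧ ∀ y : E3, hessNorm f0 y ≤ C * (1 + ‖y‖ ^ 2) ^ (-(5:ℝ)/6) := by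
  have hc : Continuous (fun X : E3 => √ (∑ i, ∑ j, (H2 i j X) ^ 2)) := by
    have := H2_cont
    fun_prop
  obtain ⟨C, hC⟩ := (isCompact_closedBall (0 : E3) 1).exists_bound_of_continuousOn hc.continuousOn
  refine ⟨C, (norm_nonneg _).trans (hC 0 (by simp)), fun y => ?_⟩
  have h1 := hC _ (mem_closedBall_zero_iff.mpr (norm_resc y))
  have h2 : hessNorm f0 y = (1 + ‖y‖ ^ 2) ^ (-(5:ℝ)/6) *
      √ (∑ i, ∑ j, (H2 i j ((1 + ‖y‖ ^ 2) ^ (-(1:ℝ)/2) • y)) ^ 2) := by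
    unfold hessNorm
    simp only [hess_f0, FF, mul_pow, ← Finset.mul_sum]
    rw [Real.sqrt_mul (by positivity), Real.sqrt_sq (by positivity)]
  rw [h2, mul_comm]
  apply mul_le_mul_of_nonneg_right _ (by positivity)
  exact (le_abs_self _).trans h1

lemma integrand_f0 (r : ℝ) (hr : 0 < r) (x : E3) (hx : ‖x‖ = 1) (q : ℝ) (hq : 0 < q)
    (hq6 : q = (1 + r ^ 2) ^ ((1:ℝ)/6)) :
    r ^ 2 * admAngMomIntegrand f0 (r • x) =
      r * q * al ((r / q ^ 3) • x) + Phi (r / q ^ 3) (1 / q ^ 4) ((r / q ^ 3) • x) := by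
  have hn : ‖r • x‖ = r := by rw [norm_smul, hx]; simp [abs_of_pos hr]
  have hlt : gradNorm f0 (r • x) ^ 2 < 1 := by
    have h1 := gradNorm_f0_le (r • x)
    have h2 := s_le_one (r • x)
    have h3 : 0 ≤ gradNorm f0 (r • x) := Real.sqrt_nonneg _
    nlinarith
  rw [integrand_eq _ _ hlt]
  rw [gradNorm_f0_sq] at hlt ⊢
  have spos : 0 < 1 + r ^ 2 := by positivity
  have e1 : (1 + r ^ 2) ^ (-(1:ℝ)/3) = 1 / q ^ 2 := by
    rw [hq6, ← Real.rpow_natCast (_ ^ _), ← Real.rpow_mul spos.le, one_div, ← Real.rpow_neg spos.le]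
    norm_num
  have e2 : (1 + r ^ 2) ^ (-(1:ℝ)/2) = 1 / q ^ 3 := by
    rw [hq6, ← Real.rpow_natCast (_ ^ _), ← Real.rpow_mul spos.le, one_div, ← Real.rpow_neg spos.le]
    norm_num
  have e3 : (1 + r ^ 2) ^ (-(5:ℝ)/6) = 1 / q ^ 5 := by
    rw [hq6, ← Real.rpow_natCast (_ ^ _), ← Real.rpow_mul spos.le, one_div, ← Real.rpow_neg spos.le]
    norm_num
  simp only [pderiv_f0, hess_f0, FF, hn, e1, e2, e3] at hlt ⊢
  have hX : (1 / q ^ 3) • r • x = (r / q ^ 3) • x := by rw [smul_smul]; congr 1; ring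
  rw [hX] at hlt ⊢
  set X := (r / q ^ 3) • x with hXd
  have hrx : r • x = q ^ 3 • X := by rw [hXd, smul_smul]; congr 1; field_simp
  rw [hrx]
  have hrot : ∀ i, rotationField (q ^ 3 • X) i = q ^ 3 * rotationField X i := by
    intro i; fin_cases i <;> simp [rotationField]
  have t1 : ∑ i, ∑ j, 1 / q ^ 5 * H2 i j X * rotationField (q ^ 3 • X) i * (q ^ 3 • X) j
      = q * al X := by
    simp only [al, Finset.mul_sum, hrot, PiLp.smul_apply, smul_eq_mul]
    refine Finset.sum_congr rfl fun i _ => Finset.sum_congr rfl fun j _ => ?_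
    field_simp
  have t2 : ∑ i, 1 / q ^ 2 * P1 i X * rotationField (q ^ 3 • X) i = q * be X := by
    simp only [be, Finset.mul_sum, hrot]
    refine Finset.sum_congr rfl fun i _ => ?_
    field_simp
  have t3 : ∑ i, 1 / q ^ 2 * P1 i X * (q ^ 3 • X) i = q * ga X := by
    simp only [ga, Finset.mul_sum, PiLp.smul_apply, smul_eq_mul]
    refine Finset.sum_congr rfl fun i _ => ?_
    field_simp
  have t4 : ∑ i, 1 / q ^ 5 * H2 i i X = 1 / q ^ 5 * de X := by
    simp only [de, Finset.mul_sum]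
  have t5 : ∑ a, ∑ b, 1 / q ^ 2 * P1 a X * (1 / q ^ 2 * P1 b X) * (1 / q ^ 5 * H2 a b X)
      = 1 / q ^ 9 * qq X := by
    simp only [qq, Finset.mul_sum]
    refine Finset.sum_congr rfl fun i _ => Finset.sum_congr rfl fun j _ => ?_
    field_simp
  have t6 : (1 / q ^ 2) ^ 2 * gg X = 1 / q ^ 4 * gg X := by
    congr 1; field_simp
  rw [t1, t2, t3, t4, t5]
  rw [t6] at hlt ⊢
  unfold Phi
  have hw : 0 < √(1 - 1 / q ^ 4 * gg X) := Real.sqrt_pos.mpr (by linarith)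
  have hw2 : √(1 - 1 / q ^ 4 * gg X) ^ 2 = 1 - 1 / q ^ 4 * gg X :=
    Real.sq_sqrt (by linarith)
  set w := √(1 - 1 / q ^ 4 * gg X)
  rw [← hw2]
  have hg : gg X = q ^ 4 * (1 - w ^ 2) := by
    rw [hw2]; field_simp; ring
  rw [hg]
  have hw1 : 1 + w ≠ 0 := by positivity
  field_simp
  ring

/-- squared length in coordinates -/
def nn (X : E3) : ℝ := X 0 ^ 2 + X 1 ^ 2 + X 2 ^ 2

lemma al_eq (X : E3) : al X = (2/3 * nn X * X 1
    + (1 - 5/3 * nn X) * (X 0 ^ 2 - X 1 ^ 2)) / 100 := by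
  simp [al, nn, H2, P1, DP1, dl, Fin.sum_univ_three, rotationField]
  ring

lemma be_eq (X : E3) : be X = (X 0 ^ 2 - X 1 ^ 2 - X 1) / 100 := by
  simp [be, P1, dl, Fin.sum_univ_three, rotationField]
  ring

lemma ga_eq (X : E3) : ga X = (X 0 + 2 * X 0 * X 1
    - nn X * (2/3 * X 0 + 5/3 * X 0 * X 1)) / 100 := by
  simp [ga, nn, P1, dl, Fin.sum_univ_three]
  ring

lemma de_eq (X : E3) : de X = (-(2/3) * (X 0 + 2 * X 0 * X 1
    - nn X * (2/3 * X 0 + 5/3 * X 0 * X 1)) - 3 * (2/3 * X 0 + 5/3 * X 0 * X 1)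
    - (2/3 * X 0 + 10/3 * X 0 * X 1) - 2 * X 0 * X 1
    + nn X * (2/3 * X 0 + 5/3 * X 0 * X 1) + nn X * (2/3 * X 0 + 10/3 * X 0 * X 1)) / 100 := by
  simp [de, nn, H2, P1, DP1, dl, Fin.sum_univ_three]
  ring

lemma gg_eq (X : E3) : gg X = ((1 + X 1) ^ 2 + X 0 ^ 2
    - 2 * (2/3 * X 0 + 5/3 * X 0 * X 1) * (X 0 + 2 * X 0 * X 1)
    + nn X * (2/3 * X 0 + 5/3 * X 0 * X 1) ^ 2) / 10000 := by
  simp [gg, nn, P1, dl, Fin.sum_univ_three]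
  ring

lemma int_al (l : ℝ) : ∫ x : Sphere2, al (l • x.1) ∂sphereMeasure = 0 := by
  have h : ∀ x : Sphere2, al (l • x.1) = (2/3 * l ^ 3 / 100) * x.1 1
      + ((1 - 5/3 * l ^ 2) * l ^ 2 / 100) * (x.1 0 ^ 2 - x.1 1 ^ 2) := by
    intro x
    have hn : nn (l • x.1) = l ^ 2 := by
      simp only [nn, PiLp.smul_apply, smul_eq_mul]
      linear_combination l ^ 2 * sphere_sq x
    rw [al_eq, hn]
    simp only [PiLp.smul_apply, smul_eq_mul]
    ring
  simp only [h]
  rw [sphere_iadd _ _ (by fun_prop) (by fun_prop), integral_const_mul, integral_const_mul,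
    moment_lin, moment_diff]
  simp

/-- the limit integrand, as a polynomial -/
noncomputable def limPoly (x y : ℝ) : ℝ :=
  -(1/3) * ((x * (1 + y)) ^ 2 / 9 + (1 + y) ^ 2 + x ^ 2 - x ^ 2 * (1 + 2 * y) ^ 2)
      * (x ^ 2 - y ^ 2 - y)
    + (1/3) * (x * (1 + y)) * (x ^ 2 - y ^ 2 - y)
      * (4/9 * (x * (1 + y)) - 2 * x - 6 * x * y)

lemma Phi_lim (x : Sphere2) : Phi 1 0 x.1 = limPoly (x.1 0) (x.1 1) / 1000000 := by
  have hn : nn x.1 = 1 := sphere_sq x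
  unfold Phi limPoly
  simp only [zero_mul, sub_zero, Real.sqrt_one, al_eq, be_eq, ga_eq, de_eq, gg_eq, hn]
  ring

lemma int_Phi_lim : ∃ c : ℝ, 0 < c ∧ ∫ x : Sphere2, Phi 1 0 x.1 ∂sphereMeasure = c := by
  obtain ⟨B, hB, m22, m40, m04, m20, m02⟩ := moments
  refine ⟨4 * B / 1000000, by positivity, ?_⟩
  simp only [Phi_lim]
  rw [integral_div]
  congr 1
  have hc1 : Continuous (fun x : Sphere2 => limPoly (x.1 0) (x.1 1)) := by unfold limPoly; fun_prop
  have hc2 : Continuous (fun x : Sphere2 => limPoly (x.1 0) (-x.1 1)) := by unfold limPoly; fun_prop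
  have hc3 : Continuous (fun x : Sphere2 => limPoly (x.1 1) (x.1 0)) := by unfold limPoly; fun_prop
  have hc4 : Continuous (fun x : Sphere2 => limPoly (x.1 1) (-x.1 0)) := by unfold limPoly; fun_prop
  have s1 := sphere_flip (fun a b _ => limPoly a b)
  have s2 := sphere_swap (fun a b _ => limPoly a b)
  have s3 := sphere_swap (fun a b _ => limPoly a (-b))
  have key : ∫ x : Sphere2, (limPoly (x.1 0) (x.1 1) + limPoly (x.1 0) (-x.1 1) + limPoly (x.1 1) (x.1 0)
      + limPoly (x.1 1) (-x.1 0)) ∂sphereMeasure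
      = ∫ x : Sphere2, ((-(4/9)) * x.1 0 ^ 4 + (-(4/9)) * x.1 1 ^ 4
        + (16/3) * (x.1 0 ^ 2 * x.1 1 ^ 2) + (4/3) * x.1 0 ^ 2 + (4/3) * x.1 1 ^ 2)
        ∂sphereMeasure := by
    congr 1
    ext x
    unfold limPoly
    ring
  rw [sphere_iadd _ _ (by fun_prop) hc4, sphere_iadd _ _ (by fun_prop) hc3,
    sphere_iadd _ _ hc1 hc2] at key
  simp (disch := fun_prop) only [sphere_iadd, integral_const_mul] at key
  rw [m22, m40, m04, m20, m02] at key
  linarith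

/-- compact parameter set -/
def KK : Set (ℝ × ℝ × E3) := Set.Icc 0 1 ×ˢ Set.Icc 0 1 ×ˢ Metric.closedBall 0 1

lemma KK_compact : IsCompact KK :=
  isCompact_Icc.prod (isCompact_Icc.prod (isCompact_closedBall _ _))

lemma Phi_contOn : ContinuousOn (fun z : ℝ × ℝ × E3 => Phi z.1 z.2.1 z.2.2) KK := by
  have h : ∀ z ∈ KK, 0 < 1 - z.2.1 * gg z.2.2 := by
    rintro ⟨l, t, X⟩ ⟨_, ht, hX⟩
    have h1 := gg_le X (mem_closedBall_zero_iff.mp hX)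
    have h2 := gg_nonneg X
    have h3 : t ≤ 1 := ht.2
    have h4 : 0 ≤ t := ht.1
    simp only
    nlinarith
  have c1 := al_cont
  have c2 := be_cont
  have c3 := ga_cont
  have c4 := de_cont
  have c5 := qq_cont
  have c6 := gg_cont
  unfold Phi
  refine ContinuousOn.mul (by fun_prop) (ContinuousOn.add ?_ ?_)
  · refine ContinuousOn.div (by fun_prop) (by fun_prop) fun z hz => ?_
    have := Real.sqrt_pos.mpr (h z hz)
    positivity
  · refine ContinuousOn.div (ContinuousOn.mul (by fun_prop) (ContinuousOn.add (by fun_prop)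
      (ContinuousOn.div (by fun_prop) (by fun_prop) fun z hz => (h z hz).ne'))) (by fun_prop)
      fun z hz => ?_
    exact (Real.sqrt_pos.mpr (h z hz)).ne'

lemma mem_KK (l t : ℝ) (hl : l ∈ Set.Icc (0:ℝ) 1) (ht : t ∈ Set.Icc (0:ℝ) 1) (x : Sphere2) :
    (l, t, l • x.1) ∈ KK := by
  refine ⟨hl, ht, ?_⟩
  rw [mem_closedBall_zero_iff, norm_smul, norm_eq_of_mem_sphere x, Real.norm_eq_abs,
    abs_of_nonneg hl.1, mul_one]
  exact hl.2

lemma Phi_sphere_cont (l t : ℝ) (hl : l ∈ Set.Icc (0:ℝ) 1) (ht : t ∈ Set.Icc (0:ℝ) 1) :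
    Continuous (fun x : Sphere2 => Phi l t (l • x.1)) :=
  Phi_contOn.comp_continuous (f := fun x : Sphere2 => (l, t, l • x.1)) (by fun_prop)
    (fun x => mem_KK l t hl ht x)

lemma tendsto_Phi (l t : ℝ → ℝ) (hl : ∀ᶠ r in atTop, l r ∈ Set.Icc (0:ℝ) 1)
    (ht : ∀ᶠ r in atTop, t r ∈ Set.Icc (0:ℝ) 1)
    (l1 : Tendsto l atTop (nhds 1)) (t0 : Tendsto t atTop (nhds 0)) :
    Tendsto (fun r => ∫ x : Sphere2, Phi (l r) (t r) (l r • x.1) ∂sphereMeasure) atTop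
      (nhds (∫ x : Sphere2, Phi 1 0 x.1 ∂sphereMeasure)) := by
  obtain ⟨C, hC⟩ := KK_compact.exists_bound_of_continuousOn Phi_contOn
  apply tendsto_integral_filter_of_dominated_convergence (fun _ => C)
  · filter_upwards [hl, ht] with r h1 h2
    exact (Phi_sphere_cont _ _ h1 h2).aestronglyMeasurable
  · filter_upwards [hl, ht] with r h1 h2
    exact Filter.Eventually.of_forall fun x => hC _ (mem_KK _ _ h1 h2 x)
  · exact integrable_const C
  · refine Filter.Eventually.of_forall fun x => ?_
    have hmem : ((1:ℝ), (0:ℝ), x.1) ∈ KK := by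
      have := mem_KK 1 0 (by simp) (by simp) x
      simpa using this
    have h := Phi_contOn _ hmem
    have hten : Tendsto (fun r => (l r, t r, l r • x.1)) atTop
        (nhdsWithin ((1:ℝ), (0:ℝ), x.1) KK) := by
      apply tendsto_nhdsWithin_of_tendsto_nhds_of_eventually_within
      · refine l1.prodMk_nhds (t0.prodMk_nhds ?_)
        have := l1.smul_const x.1
        simpa using this
      · filter_upwards [hl, ht] with r h1 h2
        exact mem_KK _ _ h1 h2 x
    exact h.tendsto.comp hten

noncomputable def qf (r : ℝ) : ℝ := (1 + r ^ 2) ^ ((1:ℝ)/6)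

lemma qf_one_le (r : ℝ) : 1 ≤ qf r :=
  Real.one_le_rpow (by nlinarith [sq_nonneg r]) (by norm_num)

lemma qf_six (r : ℝ) : qf r ^ 6 = 1 + r ^ 2 := by
  unfold qf
  rw [← Real.rpow_natCast (_ ^ _), ← Real.rpow_mul (by positivity)]
  norm_num

lemma qf_tendsto : Tendsto (fun r => (qf r)⁻¹) atTop (nhds 0) := by
  apply tendsto_inv_atTop_zero.comp
  apply (tendsto_rpow_atTop (by norm_num : (0:ℝ) < 1/6)).comp
  apply tendsto_atTop_add_const_left
  exact tendsto_pow_atTop (by norm_num)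

lemma l_eq (r : ℝ) (hr : 0 < r) : r / qf r ^ 3 = √(1 - (qf r)⁻¹ ^ 6) := by
  have hq : 0 < qf r := lt_of_lt_of_le one_pos (qf_one_le r)
  symm
  rw [Real.sqrt_eq_iff_mul_self_eq_of_pos (by positivity)]
  have := qf_six r
  have h2 : r ^ 2 = qf r ^ 6 - 1 := by linarith
  field_simp
  linarith

/-- **There are asymptotically flat spacelike hypersurfaces in the Minkowski
spacetime with finite, nonzero ADM angular momentum.**  There exist a smooth
`f : ℝ³ → ℝ` with `sup ‖∇f‖ < 1`, whose graph data decay like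
`‖∇f‖ = O(r^{−2/3})`, `‖∇²f‖ = O(r^{−5/3})` (so `g = δ + O(r^{−4/3})`,
`k = O(r^{−5/3})`), and a constant `c ≠ 0` such that the ADM angular momentum
`lim_{r→∞} (1/8π) ∫_{S_r} Σ_{i,j} π_{ij} Yⁱ νʲ dA` exists and equals `c`;
here the integral over `S_r` is written as `r²` times the integral over the
unit sphere of the integrand evaluated at `r • x`. -/
theorem exists_graph_nonzero_adm_angular_momentum :
    ∃ (f : E3 → ℝ) (c : ℝ), ContDiff ℝ (⊤ : ℕ∞) f ∧
      (∃ θ : ℝ, θ < 1 ∧ ∀ x : E3, gradNorm f x ≤ θ) ∧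
      (∃ C : ℝ, ∀ x : E3, 1 ≤ ‖x‖ →
        gradNorm f x ≤ C * ‖x‖ ^ (-(2 : ℝ) / 3) ∧
        hessNorm f x ≤ C * ‖x‖ ^ (-(5 : ℝ) / 3)) ∧
      c ≠ 0 ∧
      Filter.Tendsto
        (fun r : ℝ => (1 / (8 * π)) * r ^ 2 *
          ∫ x : Sphere2, admAngMomIntegrand f (r • (x : E3)) ∂sphereMeasure)
        Filter.atTop (nhds c) := by
  obtain ⟨c, hc, hint⟩ := int_Phi_lim
  refine ⟨f0, (1 / (8 * π)) * c, FF_contDiff _ _ p0_contDiff, ⟨1/2, by norm_num, ?_⟩, ?_,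
    by positivity, ?_⟩
  · intro x
    have h1 := gradNorm_f0_le x
    have h2 := s_le_one x
    linarith
  · obtain ⟨C, hC0, hC⟩ := hessNorm_f0_le
    refine ⟨C + 1 / 2, fun x hx => ⟨?_, ?_⟩⟩
    · have h1 := gradNorm_f0_le x
      have h2 := s_le_pow x hx (-(1:ℝ)/3) (by norm_num)
      rw [show (2:ℝ) * (-1 / 3) = -2 / 3 by norm_num] at h2
      have h3 : 0 ≤ ‖x‖ ^ (-(2:ℝ)/3) := by positivity
      nlinarith
    · have h1 := hC x
      have h2 := s_le_pow x hx (-(5:ℝ)/6) (by norm_num)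
      rw [show (2:ℝ) * (-5 / 6) = -5 / 3 by norm_num] at h2
      have h3 : 0 ≤ ‖x‖ ^ (-(5:ℝ)/3) := by positivity
      nlinarith
  · have hl : ∀ᶠ r in atTop, r / qf r ^ 3 ∈ Set.Icc (0:ℝ) 1 := by
      filter_upwards [eventually_gt_atTop 0] with r hr
      rw [l_eq r hr]
      refine ⟨Real.sqrt_nonneg _, ?_⟩
      apply Real.sqrt_le_one.mpr
      have : 0 ≤ (qf r)⁻¹ ^ 6 := by positivity
      linarith
    have ht : ∀ᶠ r in atTop, 1 / qf r ^ 4 ∈ Set.Icc (0:ℝ) 1 := by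
      refine Filter.Eventually.of_forall fun r => ?_
      have h1 : 1 ≤ qf r ^ 4 := one_le_pow₀ (qf_one_le r)
      exact ⟨by positivity, by rw [div_le_one (by linarith)]; exact h1⟩
    have l1 : Tendsto (fun r => r / qf r ^ 3) atTop (nhds 1) := by
      have h : Tendsto (fun r => √(1 - (qf r)⁻¹ ^ 6)) atTop (nhds 1) := by
        have := ((qf_tendsto.pow 6).const_sub 1).sqrt
        simpa using this
      refine h.congr' ?_
      filter_upwards [eventually_gt_atTop 0] with r hr
      exact (l_eq r hr).symm
    have t0 : Tendsto (fun r => 1 / qf r ^ 4) atTop (nhds 0) := by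
      have := qf_tendsto.pow 4
      simpa using this
    have main := (tendsto_Phi _ _ hl ht l1 t0).const_mul (1 / (8 * π))
    rw [hint] at main
    refine main.congr' ?_
    filter_upwards [eventually_gt_atTop 0, hl, ht] with r hr hlr htr
    rw [mul_assoc]
    congr 1
    rw [← integral_const_mul]
    have hq : 0 < qf r := lt_of_lt_of_le one_pos (qf_one_le r)
    have e : ∀ x : Sphere2, r ^ 2 * admAngMomIntegrand f0 (r • x.1) =
        r * qf r * al ((r / qf r ^ 3) • x.1)
          + Phi (r / qf r ^ 3) (1 / qf r ^ 4) ((r / qf r ^ 3) • x.1) :=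
      fun x => integrand_f0 r hr x.1 (norm_eq_of_mem_sphere x) _ hq rfl
    simp only [e]
    have ca := al_cont
    rw [sphere_iadd _ _ (by fun_prop) (Phi_sphere_cont _ _ hlr htr), integral_const_mul, int_al]
    simp
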